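/- Let n ≥ 3 and define ψ_n(α) = (1/(2^{n-2} Γ(n/2)²)) ∫₀¹ (1-t²)^{(n-2)/2} [∫₀^∞∫₀^∞ exp(-(r² + r'² - 2rr't α)/2) (rr')^{n-2} dr dr'] dt for α ∈ [-1,1]. Then the constant c_n = ∫_{S^{n-1}}∫_{S^{n-1}} ψ_n(⟨x,y⟩) dσ_{n-1}(x) dσ_{n-1}(y) satisfies 1/(n-1) < c_n < 1/(n-2). -/

import Mathlib

open MeasureTheory Real
open scoped RealInnerProductSpace

/-- The standard Gaussian measure on `ℝⁿ`. -/
noncomputable def stdGaussian (n : ℕ) : Measure (EuclideanSpace ℝ (Fin n)) :=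
  volume.withDensity fun x =>
    ENNReal.ofReal ((2 * π) ^ (-(n : ℝ) / 2) * Real.exp (-‖x‖ ^ 2 / 2))

/-- The uniform (rotation-invariant) probability measure on the unit sphere `S^{n-1}`,
realized as the image of the standard Gaussian measure under `x ↦ x/‖x‖`. -/
noncomputable def sphereUniform (n : ℕ) : Measure (EuclideanSpace ℝ (Fin n)) :=
  (stdGaussian n).map fun x => ‖x‖⁻¹ • x

/-- The mixing density `ψ_n(α)`. -/
noncomputable def psi (n : ℕ) (α : ℝ) : ℝ :=
  (1 / (2 ^ ((n : ℝ) - 2) * Real.Gamma ((n : ℝ) / 2) ^ 2)) *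
    ∫ t in Set.Ioo (0 : ℝ) 1,
      (1 - t ^ 2) ^ (((n : ℝ) - 2) / 2) *
        ∫ r in Set.Ioi (0 : ℝ), ∫ r' in Set.Ioi (0 : ℝ),
          Real.exp (-(r ^ 2 + r' ^ 2 - 2 * r * r' * t * α) / 2) * (r * r') ^ ((n : ℝ) - 2)

open Set Filter Topology ENNReal in
lemma scaleIoi (c : ℝ) (hc : 0 < c) (f : ℝ → ENNReal) :
    ∫⁻ x in Set.Ioi (0:ℝ), f x = ENNReal.ofReal c * ∫⁻ x in Set.Ioi (0:ℝ), f (c * x) := by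
  have h := lintegral_image_eq_lintegral_deriv_mul_of_monotoneOn (s := Set.Ioi (0:ℝ))
    (f := fun x => c * x) (f' := fun _ => c) measurableSet_Ioi
    (fun x _ => by simpa using ((hasDerivAt_id x).const_mul c).hasDerivWithinAt)
    (fun x _ y _ h => by simpa using mul_le_mul_of_nonneg_left h hc.le) f
  have him : (fun x => c * x) '' Set.Ioi (0:ℝ) = Set.Ioi 0 := by
    rw [Set.image_mul_left_Ioi hc]; simp
  rw [him, lintegral_const_mul' _ _ ENNReal.ofReal_ne_top] at h
  exact h

lemma inv_gauss (a : ℝ) (ha : 0 < a) :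
    ENNReal.ofReal a⁻¹ = ENNReal.ofReal (√(2/π)) *
      ∫⁻ p in Set.Ioi (0:ℝ), ENNReal.ofReal (Real.exp (-(p^2) * a^2 / 2)) := by
  have h := integral_gaussian_Ioi (a^2/2)
  have hi : IntegrableOn (fun x : ℝ => Real.exp (-(a^2/2) * x^2)) (Set.Ioi 0) :=
    (integrable_exp_neg_mul_sq (by positivity)).integrableOn
  have h2 := ofReal_integral_eq_lintegral_ofReal hi (Filter.Eventually.of_forall fun x => (Real.exp_pos _).le)
  have h3 : ∀ p : ℝ, -(p^2) * a^2 / 2 = -(a^2/2) * p^2 := fun p => by ring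
  simp_rw [h3]
  rw [← h2, h, ← ENNReal.ofReal_mul (by positivity)]
  congr 1
  have : π / (a^2/2) = (2/a)^2 * (π/2) := by field_simp; try ring
  rw [this, Real.sqrt_mul (by positivity), Real.sqrt_sq (by positivity)]
  have h5 : √(2/π) * √(π/2) = 1 := by
    rw [← Real.sqrt_mul (by positivity)]
    have : 2/π*(π/2) = 1 := by have := pi_pos.ne'; field_simp
    rw [this, Real.sqrt_one]
  calc a⁻¹ = (√(2/π) * √(π/2)) * a⁻¹ := by rw [h5, one_mul]
    _ = _ := by field_simp

lemma gauss_volume (n : ℕ) (b : ℝ) (hb : 0 < b) (w : EuclideanSpace ℝ (Fin n)) :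
    ∫⁻ X : EuclideanSpace ℝ (Fin n), ENNReal.ofReal (Real.exp (-b * ‖X‖^2 / 2 + ⟪w, X⟫)) =
      ENNReal.ofReal ((2*π/b) ^ ((n:ℝ)/2) * Real.exp (‖w‖^2/(2*b))) := by
  have h1 : ∀ X : EuclideanSpace ℝ (Fin n), -b * ‖X‖^2 / 2 + ⟪w, X⟫ =
      -(b/2) * ‖X - (1/b) • w‖^2 + ‖w‖^2/(2*b) := fun X => by
    rw [norm_sub_sq_real, inner_smul_right, norm_smul, real_inner_comm, mul_pow]
    simp only [Real.norm_eq_abs, sq_abs]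
    field_simp
    ring
  simp_rw [h1, Real.exp_add]
  rw [lintegral_sub_right_eq_self (fun X => ENNReal.ofReal (Real.exp (-(b/2) * ‖X‖^2) * Real.exp (‖w‖^2/(2*b)))) ((1/b) • w)]
  simp_rw [ENNReal.ofReal_mul (Real.exp_pos _).le]
  rw [lintegral_mul_const' _ _ ENNReal.ofReal_ne_top, ENNReal.ofReal_mul (by positivity)]
  congr 1
  have h := GaussianFourier.integral_rexp_neg_mul_sq_norm (V := EuclideanSpace ℝ (Fin n)) (b := b/2) (by positivity)
  have hi : Integrable (fun X : EuclideanSpace ℝ (Fin n) => Real.exp (-(b/2) * ‖X‖^2)) := by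
    by_contra hcon
    rw [integral_undef hcon] at h
    have : 0 < (π / (b/2)) ^ ((Module.finrank ℝ (EuclideanSpace ℝ (Fin n)) : ℝ) / 2) := by positivity
    linarith
  rw [← ofReal_integral_eq_lintegral_ofReal hi (Filter.Eventually.of_forall fun x => (Real.exp_pos _).le), h]
  congr 2
  · field_simp
  · simp

lemma gauss_mgf (n : ℕ) (a : ℝ) (ha : 0 < 1 + a) (w : EuclideanSpace ℝ (Fin n)) :
    ∫⁻ X, ENNReal.ofReal (Real.exp (-a * ‖X‖^2 / 2 + ⟪w, X⟫)) ∂(stdGaussian n) =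
      ENNReal.ofReal ((1+a) ^ (-(n:ℝ)/2) * Real.exp (‖w‖^2/(2*(1+a)))) := by
  rw [stdGaussian, lintegral_withDensity_eq_lintegral_mul₀ (by fun_prop) (by fun_prop)]
  have h1 : ∀ X : EuclideanSpace ℝ (Fin n), ((fun x : EuclideanSpace ℝ (Fin n) => ENNReal.ofReal ((2 * π) ^ (-(n : ℝ) / 2) * Real.exp (-‖x‖ ^ 2 / 2))) *
      (fun X => ENNReal.ofReal (Real.exp (-a * ‖X‖^2 / 2 + ⟪w, X⟫)))) X =
      ENNReal.ofReal ((2 * π) ^ (-(n : ℝ) / 2)) * ENNReal.ofReal (Real.exp (-(1+a) * ‖X‖^2 / 2 + ⟪w, X⟫)) := fun X => by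
    simp only [Pi.mul_apply]
    rw [ENNReal.ofReal_mul (by positivity), mul_assoc, ← ENNReal.ofReal_mul (by positivity), ← Real.exp_add]
    congr 3; ring
  simp_rw [h1]
  rw [lintegral_const_mul' _ _ ENNReal.ofReal_ne_top, gauss_volume n _ ha, ← ENNReal.ofReal_mul (by positivity), ← mul_assoc]
  congr 2
  rw [Real.div_rpow (by positivity) ha.le, neg_div, Real.rpow_neg (by positivity), Real.rpow_neg ha.le]
  field_simp

/-- `κ_m`. -/
noncomputable def kapR (m : ℕ) : ℝ := ∫ z in Set.Ioi (0:ℝ), (1 + z^2) ^ (-(m:ℝ)/2)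

lemma kap_int (m : ℕ) (hm : 2 ≤ m) : Integrable (fun z : ℝ => (1 + z^2) ^ (-(m:ℝ)/2)) := by
  have := integrable_rpow_neg_one_add_norm_sq (E := ℝ) (μ := volume) (r := m) (by simp; omega)
  simpa using this

lemma kapR_pos (m : ℕ) (hm : 2 ≤ m) : 0 < kapR m := by
  unfold kapR
  rw [setIntegral_pos_iff_support_of_nonneg_ae]
  · have : (Function.support fun z : ℝ => (1 + z^2) ^ (-(m:ℝ)/2)) = Set.univ := by
      ext z; simp only [Function.mem_support, Set.mem_univ, iff_true]; positivity
    simp [this]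
  · exact Filter.Eventually.of_forall fun z => by simp only [Pi.zero_apply]; positivity
  · exact (kap_int m hm).integrableOn

lemma kapR_le (m : ℕ) (hm : 2 ≤ m) : kapR (m+1) ≤ kapR m := by
  unfold kapR
  refine setIntegral_mono (kap_int _ (by omega)).integrableOn (kap_int m hm).integrableOn fun z => ?_
  refine Real.rpow_le_rpow_of_exponent_le (by nlinarith [sq_nonneg z]) ?_
  push_cast; linarith

lemma kap_tendsto (m : ℕ) (hm : 2 ≤ m) :
    Filter.Tendsto (fun z : ℝ => z * (1 + z^2) ^ (-(m:ℝ)/2)) Filter.atTop (nhds 0) := by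
  refine squeeze_zero' (g := fun z : ℝ => z⁻¹) ?_ ?_ tendsto_inv_atTop_zero
  · filter_upwards [Filter.eventually_gt_atTop 0] with z hz; positivity
  · filter_upwards [Filter.eventually_gt_atTop 0] with z hz
    have h1 : (1 + z^2) ^ (-(m:ℝ)/2) ≤ (1+z^2) ^ (-1 : ℝ) := by
      refine Real.rpow_le_rpow_of_exponent_le (by nlinarith [sq_nonneg z]) ?_
      have : (2:ℝ) ≤ m := by exact_mod_cast hm
      linarith
    rw [Real.rpow_neg_one] at h1
    calc z * (1 + z^2) ^ (-(m:ℝ)/2) ≤ z * (1+z^2)⁻¹ := by gcongr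
      _ ≤ z * (z^2)⁻¹ := by gcongr; linarith
      _ = z⁻¹ := by field_simp

lemma kap_rec (m : ℕ) (hm : 2 ≤ m) : (m:ℝ) * kapR (m+2) = (m-1) * kapR m := by
  have hd : ∀ z : ℝ, HasDerivAt (fun z : ℝ => z * (1 + z^2) ^ (-(m:ℝ)/2))
      ((1 - m) * (1 + z^2) ^ (-(m:ℝ)/2) + m * (1 + z^2) ^ (-((m+2:ℕ):ℝ)/2)) z := fun z => by
    have h1 : HasDerivAt (fun z : ℝ => 1 + z^2) (2 * z) z := by
      simpa using ((hasDerivAt_pow 2 z).const_add 1)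
    have hpos : 0 < 1 + z^2 := by positivity
    have h2 := h1.rpow_const (p := -(m:ℝ)/2) (Or.inl hpos.ne')
    have h3 := (hasDerivAt_id z).mul h2
    refine h3.congr_deriv ?_
    have e1 : (1 + z^2) ^ (-(m:ℝ)/2) = (1+z^2) * (1 + z^2) ^ (-((m+2:ℕ):ℝ)/2) := by
      rw [← Real.rpow_one_add' hpos.le]
      · congr 1; push_cast; ring
      · push_cast; have : (2:ℝ) ≤ m := by exact_mod_cast hm
        linarith
    have e2 : -(m:ℝ)/2 - 1 = -((m+2:ℕ):ℝ)/2 := by push_cast; ring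
    rw [e2, e1]; simp only [id]; ring
  have i1 := (kap_int m hm).integrableOn (s := Set.Ioi (0:ℝ))
  have i2 := (kap_int (m+2) (by omega)).integrableOn (s := Set.Ioi (0:ℝ))
  have h := integral_Ioi_of_hasDerivAt_of_tendsto' (a := 0) (fun x _ => hd x)
    ((i1.const_mul _).add (i2.const_mul _)) (kap_tendsto m hm)
  rw [integral_add (i1.const_mul _) (i2.const_mul _), integral_const_mul, integral_const_mul] at h
  simp only [zero_mul, sub_zero] at h
  unfold kapR
  linarith

lemma kap_two : kapR 2 = π/2 := by
  have h := integral_Ioi_inv_one_add_sq (i := 0)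
  rw [Real.arctan_zero, sub_zero] at h
  rw [← h]; unfold kapR
  congr 1; ext z
  norm_num [Real.rpow_neg_one]

lemma kap_three : kapR 3 = 1 := by
  have hd : ∀ z : ℝ, HasDerivAt (fun z : ℝ => z * (1 + z^2) ^ (-(1:ℝ)/2))
      ((1 + z^2) ^ (-((3:ℕ):ℝ)/2)) z := fun z => by
    have h1 : HasDerivAt (fun z : ℝ => 1 + z^2) (2 * z) z := by
      simpa using ((hasDerivAt_pow 2 z).const_add 1)
    have hpos : 0 < 1 + z^2 := by positivity
    have h2 := h1.rpow_const (p := -(1:ℝ)/2) (Or.inl hpos.ne')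
    have h3 := (hasDerivAt_id z).mul h2
    refine h3.congr_deriv ?_
    have e1 : (1 + z^2) ^ (-(1:ℝ)/2) = (1+z^2) * (1 + z^2) ^ (-((3:ℕ):ℝ)/2) := by
      rw [← Real.rpow_one_add' hpos.le]
      · congr 1; push_cast; ring
      · push_cast; norm_num
    have e2 : -(1:ℝ)/2 - 1 = -((3:ℕ):ℝ)/2 := by push_cast; ring
    rw [e2, e1]; simp only [id]; ring
  have ht : Filter.Tendsto (fun z : ℝ => z * (1 + z^2) ^ (-(1:ℝ)/2)) Filter.atTop (nhds 1) := by
    have h1 : Filter.Tendsto (fun z : ℝ => (1 + (z⁻¹)^2) ^ (-(1:ℝ)/2)) Filter.atTop (nhds ((1 + 0^2) ^ (-(1:ℝ)/2))) := by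
      refine Filter.Tendsto.rpow_const ?_ (Or.inl (by norm_num))
      exact (tendsto_inv_atTop_zero.pow 2).const_add 1
    norm_num at h1
    refine Filter.Tendsto.congr' ?_ h1
    filter_upwards [Filter.eventually_gt_atTop 0] with z hz
    have : 1 + (z^2)⁻¹ = (1+z^2) * (z⁻¹)^2 := by field_simp; ring
    rw [this, Real.mul_rpow (by positivity) (by positivity), ← Real.rpow_natCast z⁻¹ 2, ← Real.rpow_mul (by positivity)]
    norm_num [Real.rpow_neg_one]
    ring
  have h := integral_Ioi_of_hasDerivAt_of_tendsto' (a := 0) (fun x _ => hd x)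
    ((kap_int 3 (by norm_num)).integrableOn) ht
  simp only [zero_mul, sub_zero] at h
  exact h

lemma kap_prod (k : ℕ) : kapR (k+2) * kapR (k+3) = (π/2) / (k+1) := by
  induction k with
  | zero => simp [kap_two, kap_three]
  | succ k ih =>
    have h := kap_rec (k+2) (by omega)
    push_cast at h
    have e : kapR (k+1+3) = (k+1) / (k+2) * kapR (k+2) := by
      have : (k:ℝ) + 2 ≠ 0 := by positivity
      rw [show k+1+3 = k+2+2 by ring]
      field_simp
      linarith
    rw [show k+1+2 = k+3 by ring, e]
    push_cast
    have : kapR (k+3) * (((k:ℝ)+1)/(k+2) * kapR (k+2)) = (k+1)/(k+2) * (kapR (k+2) * kapR (k+3)) := by ring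
    rw [this, ih]
    field_simp
    ring

lemma kap_lint (m : ℕ) (hm : 2 ≤ m) :
    ∫⁻ z in Set.Ioi (0:ℝ), ENNReal.ofReal ((1 + z^2) ^ (-(m:ℝ)/2)) = ENNReal.ofReal (kapR m) := by
  unfold kapR
  rw [ofReal_integral_eq_lintegral_ofReal (kap_int m hm).integrableOn]
  exact Filter.Eventually.of_forall fun z => by simp only [Pi.zero_apply]; positivity

instance (n : ℕ) : SFinite (stdGaussian n) := by unfold stdGaussian; infer_instance

instance (n : ℕ) : SFinite (sphereUniform n) := by unfold sphereUniform; infer_instance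

lemma polar (n : ℕ) (hn : 1 ≤ n) (f : EuclideanSpace ℝ (Fin n) → ENNReal) (hf : Measurable f) :
    ∫⁻ x, f x = ∫⁻ θ : Metric.sphere (0 : EuclideanSpace ℝ (Fin n)) 1, (∫⁻ r in Set.Ioi (0:ℝ),
      ENNReal.ofReal (r^(n-1)) * f (r • (θ : EuclideanSpace ℝ (Fin n))))
        ∂(volume : Measure (EuclideanSpace ℝ (Fin n))).toSphere := by
  have : Nonempty (Fin n) := ⟨⟨0, hn⟩⟩
  set μ : Measure (EuclideanSpace ℝ (Fin n)) := volume
  have hfr : Module.finrank ℝ (EuclideanSpace ℝ (Fin n)) = n := by simp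
  calc ∫⁻ x, f x ∂μ = ∫⁻ x in ({0}ᶜ : Set (EuclideanSpace ℝ (Fin n))), f x ∂μ := by
        rw [restrict_compl_singleton]
    _ = ∫⁻ x : ({(0)}ᶜ : Set (EuclideanSpace ℝ (Fin n))), f x ∂(μ.comap (↑)) := by
        rw [lintegral_subtype_comap (measurableSet_singleton _).compl]
    _ = ∫⁻ z, f (z.2.1 • (z.1 : EuclideanSpace ℝ (Fin n))) ∂(μ.toSphere.prod (Measure.volumeIoiPow (Module.finrank ℝ (EuclideanSpace ℝ (Fin n)) - 1))) := by
        rw [← μ.measurePreserving_homeomorphUnitSphereProd.lintegral_comp_emb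
          (Homeomorph.measurableEmbedding _)]
        refine lintegral_congr fun x => ?_
        congr 1
        have := homeomorphUnitSphereProd_symm_apply_coe (EuclideanSpace ℝ (Fin n)) (homeomorphUnitSphereProd _ x)
        rw [Homeomorph.symm_apply_apply] at this
        exact this
    _ = ∫⁻ θ, (∫⁻ r, f (r.1 • (θ : EuclideanSpace ℝ (Fin n))) ∂(Measure.volumeIoiPow (n - 1))) ∂μ.toSphere := by
        rw [hfr, lintegral_prod]
        exact (hf.comp (by fun_prop)).aemeasurable
    _ = _ := by
        refine lintegral_congr fun θ => ?_
        rw [Measure.volumeIoiPow, lintegral_withDensity_eq_lintegral_mul₀ (by fun_prop)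
          (g := fun r : Set.Ioi (0:ℝ) => f (r.1 • (θ : EuclideanSpace ℝ (Fin n)))) (hf.comp (by fun_prop)).aemeasurable]
        exact lintegral_subtype_comap measurableSet_Ioi (fun r : ℝ => ENNReal.ofReal (r^(n-1)) * f (r • (θ : EuclideanSpace ℝ (Fin n))))

/-- radial constant -/
noncomputable def Crad (n : ℕ) : ℝ := 2^((n:ℝ)/2 - 1) * Real.Gamma ((n:ℝ)/2)

lemma Crad_eq (n : ℕ) (hn : 1 ≤ n) :
    ∫⁻ r in Set.Ioi (0:ℝ), ENNReal.ofReal (r^(n-1) * Real.exp (-r^2/2)) = ENNReal.ofReal (Crad n) := by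
  have hn' : (1:ℝ) ≤ n := by exact_mod_cast hn
  have h := integral_rpow_mul_exp_neg_mul_rpow (p := 2) (q := (n:ℝ)-1) (b := 1/2) (by norm_num) (by linarith) (by norm_num)
  have hE : ∀ r ∈ Set.Ioi (0:ℝ), r^((n:ℝ)-1) * Real.exp (-(1/2) * r^(2:ℝ)) = r^(n-1) * Real.exp (-r^2/2) := by
    intro r hr
    have : ((n:ℝ)-1) = ((n-1:ℕ):ℝ) := by push_cast [hn]; ring
    rw [this, Real.rpow_natCast, Real.rpow_two]
    congr 2; ring
  rw [setIntegral_congr_fun measurableSet_Ioi hE] at h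
  have hC : (1/2:ℝ) ^ (-((n:ℝ)-1+1)/2) * (1/2) * Real.Gamma (((n:ℝ)-1+1)/2) = Crad n := by
    unfold Crad
    rw [one_div, Real.inv_rpow (by norm_num), ← Real.rpow_neg (by norm_num), Real.rpow_sub (by norm_num), Real.rpow_one]
    simp only [sub_add_cancel, neg_div, neg_neg]
    ring
  rw [hC] at h
  have hpos : 0 < Crad n := by
    unfold Crad
    have := Real.Gamma_pos_of_pos (s := (n:ℝ)/2) (by linarith)
    positivity
  rw [← ofReal_integral_eq_lintegral_ofReal, h]
  · by_contra hcon
    rw [integral_undef hcon] at h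
    linarith
  · filter_upwards [ae_restrict_mem measurableSet_Ioi] with r hr
    have : (0:ℝ) < r := hr
    simp only [Pi.zero_apply]; positivity

lemma lintegral_stdGaussian (n : ℕ) (f : EuclideanSpace ℝ (Fin n) → ENNReal) (hf : Measurable f) :
    ∫⁻ x, f x ∂(stdGaussian n) = ENNReal.ofReal ((2 * π) ^ (-(n : ℝ) / 2)) *
      ∫⁻ x, ENNReal.ofReal (Real.exp (-‖x‖ ^ 2 / 2)) * f x := by
  rw [stdGaussian, lintegral_withDensity_eq_lintegral_mul₀ (by fun_prop) hf.aemeasurable,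
    ← lintegral_const_mul' _ _ ENNReal.ofReal_ne_top]
  refine lintegral_congr fun x => ?_
  simp only [Pi.mul_apply]
  rw [ENNReal.ofReal_mul (by positivity), mul_assoc]

lemma norm_sphere_smul (n : ℕ) (θ : Metric.sphere (0 : EuclideanSpace ℝ (Fin n)) 1) (r : ℝ) (hr : 0 < r) :
    ‖r • (θ : EuclideanSpace ℝ (Fin n))‖ = r := by
  have := θ.2
  rw [mem_sphere_zero_iff_norm] at this
  rw [norm_smul, this, Real.norm_of_nonneg hr.le, mul_one]

lemma lintegral_sphereUniform (n : ℕ) (hn : 1 ≤ n) (h : EuclideanSpace ℝ (Fin n) → ENNReal) (hh : Measurable h) :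
    ∫⁻ y, h y ∂(sphereUniform n) = ENNReal.ofReal ((2 * π) ^ (-(n : ℝ) / 2)) * (ENNReal.ofReal (Crad n) *
      ∫⁻ θ : Metric.sphere (0 : EuclideanSpace ℝ (Fin n)) 1, h θ
        ∂(volume : Measure (EuclideanSpace ℝ (Fin n))).toSphere) := by
  have hm : Measurable (fun x : EuclideanSpace ℝ (Fin n) => ‖x‖⁻¹ • x) := by fun_prop
  rw [sphereUniform, lintegral_map hh hm, lintegral_stdGaussian n (fun x => h (‖x‖⁻¹ • x)) (hh.comp hm), polar n hn]
  · congr 1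
    rw [← lintegral_const_mul' _ _ ENNReal.ofReal_ne_top]
    refine lintegral_congr fun θ => ?_
    rw [← Crad_eq n hn, ← lintegral_mul_const _ (by fun_prop)]
    refine setLIntegral_congr_fun measurableSet_Ioi fun r (hr : 0 < r) => ?_
    rw [norm_sphere_smul n θ r hr, smul_smul, inv_mul_cancel₀ hr.ne', one_smul, ENNReal.ofReal_mul (by positivity), mul_assoc]
  · exact Measurable.mul (by fun_prop) (hh.comp hm)

lemma polar_main (n : ℕ) (hn : 2 ≤ n) (H : EuclideanSpace ℝ (Fin n) → ENNReal) (hH : Measurable H) :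
    ∫⁻ y, (∫⁻ r in Set.Ioi (0:ℝ), ENNReal.ofReal (r^((n:ℝ)-2) * Real.exp (-r^2/2)) * H (r • y)) ∂(sphereUniform n) =
     ENNReal.ofReal (Crad n) * ∫⁻ Y, ENNReal.ofReal (‖Y‖⁻¹) * H Y ∂(stdGaussian n) := by
  rw [lintegral_sphereUniform n (by omega), lintegral_stdGaussian, polar n (by omega), mul_left_comm]
  · congr 2
    refine lintegral_congr fun θ => ?_
    refine setLIntegral_congr_fun measurableSet_Ioi fun r (hr : 0 < r) => ?_
    rw [norm_sphere_smul n θ r hr, ← mul_assoc, ← mul_assoc, ← ENNReal.ofReal_mul (by positivity), ← ENNReal.ofReal_mul (by positivity)]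
    congr 2
    have : r^((n:ℝ)-2) = r^(n-1) * r⁻¹ := by
      rw [← Real.rpow_natCast, ← Real.rpow_neg_one r, ← Real.rpow_add hr]
      congr 1; push_cast [show 1 ≤ n by omega]; ring
    rw [this]; ring
  · exact Measurable.mul (by fun_prop) (Measurable.mul (by fun_prop) hH)
  · exact Measurable.mul (by fun_prop) hH
  · refine Measurable.lintegral_prod_right' (f := fun p : EuclideanSpace ℝ (Fin n) × ℝ => ENNReal.ofReal (p.2^((n:ℝ)-2) * Real.exp (-p.2^2/2)) * H (p.2 • p.1)) ?_
    exact Measurable.mul (by fun_prop) (hH.comp (by fun_prop))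


lemma mean_inv (n : ℕ) (hn : 1 ≤ n) (a : ℝ) (ha : 0 < 1 + a) (w : EuclideanSpace ℝ (Fin n)) :
    ∫⁻ X, ENNReal.ofReal (‖X‖⁻¹) * ENNReal.ofReal (Real.exp (-a * ‖X‖^2 / 2 + ⟪w, X⟫)) ∂(stdGaussian n) =
      ENNReal.ofReal (√(2/π)) * ∫⁻ q in Set.Ioi (0:ℝ),
        ENNReal.ofReal ((1 + (a+q^2)) ^ (-(n:ℝ)/2) * Real.exp (‖w‖^2/(2*(1 + (a+q^2))))) := by
  have : Nonempty (Fin n) := ⟨⟨0, hn⟩⟩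
  have h0 : ∀ᵐ X ∂(stdGaussian n), X ≠ 0 := by
    have : stdGaussian n ≪ volume := withDensity_absolutelyContinuous _ _
    exact this.ae_le (Measure.ae_ne volume 0)
  have h1 : ∫⁻ X, ENNReal.ofReal (‖X‖⁻¹) * ENNReal.ofReal (Real.exp (-a * ‖X‖^2 / 2 + ⟪w, X⟫)) ∂(stdGaussian n)
    = ∫⁻ X, ENNReal.ofReal (√(2/π)) * (∫⁻ q in Set.Ioi (0:ℝ), ENNReal.ofReal (Real.exp (-(a+q^2) * ‖X‖^2 / 2 + ⟪w, X⟫))) ∂(stdGaussian n) := by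
    refine lintegral_congr_ae ?_
    filter_upwards [h0] with X hX
    rw [inv_gauss ‖X‖ (norm_pos_iff.mpr hX), mul_assoc, ← lintegral_mul_const' _ _ ENNReal.ofReal_ne_top]
    congr 1
    refine lintegral_congr fun q => ?_
    rw [← ENNReal.ofReal_mul (Real.exp_pos _).le, ← Real.exp_add]
    congr 2; ring
  rw [h1, lintegral_const_mul' _ _ ENNReal.ofReal_ne_top, lintegral_lintegral_swap (by fun_prop)]
  congr 1
  refine lintegral_congr fun q => ?_
  rw [gauss_mgf n _ (by nlinarith [sq_nonneg q])]

lemma kap_scaled (n : ℕ) (hn : 2 ≤ n) (A : ℝ) (hA : 0 < A) :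
    ∫⁻ p in Set.Ioi (0:ℝ), ENNReal.ofReal ((A + p^2) ^ (-(n:ℝ)/2)) =
      ENNReal.ofReal (A ^ ((1-(n:ℝ))/2)) * ENNReal.ofReal (kapR n) := by
  rw [scaleIoi (√A) (by positivity), ← kap_lint n hn, ← lintegral_const_mul' _ _ ENNReal.ofReal_ne_top,
    ← lintegral_const_mul' _ _ ENNReal.ofReal_ne_top]
  refine lintegral_congr fun p => ?_
  rw [← ENNReal.ofReal_mul (by positivity), ← ENNReal.ofReal_mul (by positivity)]
  congr 1
  have : A + (√A * p)^2 = A * (1 + p^2) := by rw [mul_pow, Real.sq_sqrt hA.le]; ring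
  rw [this, Real.mul_rpow hA.le (by positivity), ← mul_assoc, Real.sqrt_eq_rpow, ← Real.rpow_add hA]
  congr 2; ring

/-- The double Gaussian mean. -/
noncomputable def GG (n : ℕ) (t : ℝ) : ENNReal :=
  ∫⁻ X, ENNReal.ofReal (‖X‖⁻¹) * (∫⁻ Y, ENNReal.ofReal (‖Y‖⁻¹) * ENNReal.ofReal (Real.exp (t * ⟪X, Y⟫)) ∂(stdGaussian n)) ∂(stdGaussian n)

lemma GG_eq (n : ℕ) (hn : 2 ≤ n) (t : ℝ) (ht0 : 0 < t) (ht1 : t < 1) :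
    GG n t = ENNReal.ofReal (2/π * kapR n) * ∫⁻ q in Set.Ioi (0:ℝ),
      ENNReal.ofReal ((1 + q^2) ^ (-(n:ℝ)/2) * (1 - t^2/(1+q^2)) ^ ((1-(n:ℝ))/2)) := by
  have hA : ∀ q : ℝ, 0 < 1 - t^2/(1+q^2) := fun q => by
    rw [sub_pos, div_lt_one (by positivity)]; nlinarith [sq_nonneg q]
  have h1 : ∀ X : EuclideanSpace ℝ (Fin n), ENNReal.ofReal (‖X‖⁻¹) * (∫⁻ Y, ENNReal.ofReal (‖Y‖⁻¹) * ENNReal.ofReal (Real.exp (t * ⟪X, Y⟫)) ∂(stdGaussian n)) =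
     ENNReal.ofReal (√(2/π)) * ∫⁻ q in Set.Ioi (0:ℝ), ENNReal.ofReal ((1 + q^2) ^ (-(n:ℝ)/2)) *
       (ENNReal.ofReal (‖X‖⁻¹) * ENNReal.ofReal (Real.exp (-(-t^2/(1+q^2)) * ‖X‖^2/2 + ⟪(0:EuclideanSpace ℝ (Fin n)), X⟫))) := fun X => by
    have h := mean_inv n (by omega) 0 (by norm_num) (t • X)
    simp only [neg_zero, zero_mul, zero_div, zero_add, inner_smul_left] at h
    simp only [conj_trivial] at h
    rw [h, mul_left_comm, ← lintegral_const_mul' _ _ ENNReal.ofReal_ne_top]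
    congr 1
    refine lintegral_congr fun q => ?_
    rw [mul_left_comm, ENNReal.ofReal_mul (by positivity)]
    congr 4
    rw [norm_smul, mul_pow, inner_zero_left, Real.norm_eq_abs, sq_abs]
    field_simp
    try ring
  unfold GG
  simp_rw [h1]
  rw [lintegral_const_mul' _ _ ENNReal.ofReal_ne_top, lintegral_lintegral_swap (by fun_prop)]
  have h2 : ∀ q : ℝ, ∫⁻ X : EuclideanSpace ℝ (Fin n), ENNReal.ofReal ((1 + q^2) ^ (-(n:ℝ)/2)) *
       (ENNReal.ofReal (‖X‖⁻¹) * ENNReal.ofReal (Real.exp (-(-t^2/(1+q^2)) * ‖X‖^2/2 + ⟪(0:EuclideanSpace ℝ (Fin n)), X⟫))) ∂(stdGaussian n)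
      = ENNReal.ofReal (√(2/π) * kapR n) * ENNReal.ofReal ((1 + q^2) ^ (-(n:ℝ)/2) * (1 - t^2/(1+q^2)) ^ ((1-(n:ℝ))/2)) := fun q => by
    rw [lintegral_const_mul' _ _ ENNReal.ofReal_ne_top, mean_inv n (by omega) _ (by have := hA q; rw [neg_div]; linarith)]
    have h3 : ∀ p : ℝ, (1 + (-t^2/(1+q^2) + p^2)) ^ (-(n:ℝ)/2) * Real.exp (‖(0:EuclideanSpace ℝ (Fin n))‖^2 / (2*(1 + (-t^2/(1+q^2) + p^2)))) =
      ((1 - t^2/(1+q^2)) + p^2) ^ (-(n:ℝ)/2) := fun p => by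
      rw [norm_zero, zero_pow two_ne_zero, zero_div, Real.exp_zero, mul_one]
      congr 1; ring
    simp_rw [h3]
    rw [kap_scaled n hn _ (hA q), ENNReal.ofReal_mul (by positivity), ENNReal.ofReal_mul (by positivity)]
    ring
  simp_rw [h2]
  rw [lintegral_const_mul' _ _ ENNReal.ofReal_ne_top, ← mul_assoc, ← ENNReal.ofReal_mul (by positivity), ← mul_assoc, Real.mul_self_sqrt (by positivity)]

/-- The final one-dimensional integral. -/
noncomputable def JJ (n : ℕ) (t : ℝ) : ENNReal :=
  ∫⁻ z in Set.Ioi (0:ℝ), ENNReal.ofReal ((1+z^2) ^ ((1-(n:ℝ))/2) * (1 + (1-t^2)*z^2) ^ (-(1:ℝ)/2))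

lemma GG_JJ (n : ℕ) (hn : 2 ≤ n) (t : ℝ) (ht0 : 0 < t) (ht1 : t < 1) :
    ENNReal.ofReal ((1 - t^2) ^ (((n:ℝ)-2)/2)) * GG n t = ENNReal.ofReal (2/π * kapR n) * JJ n t := by
  have hs : 0 < 1 - t^2 := by nlinarith
  rw [GG_eq n hn t ht0 ht1, mul_left_comm, scaleIoi (√(1-t^2)) (by positivity), JJ,
    ← lintegral_const_mul' _ _ ENNReal.ofReal_ne_top, ← lintegral_const_mul' _ _ ENNReal.ofReal_ne_top]
  congr 1
  refine lintegral_congr fun z => ?_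
  rw [← ENNReal.ofReal_mul (by positivity), ← ENNReal.ofReal_mul (by positivity)]
  congr 1
  rw [mul_pow, Real.sq_sqrt hs.le]
  set s := 1 - t^2 with hsd
  have hB : 0 < 1 + s * z^2 := by positivity
  have e1 : 1 - t^2/(1 + s*z^2) = s * (1+z^2) * (1 + s * z^2)⁻¹ := by
    field_simp; rw [hsd]; ring
  rw [e1, Real.mul_rpow (by positivity) (by positivity), Real.mul_rpow (by positivity) (by positivity),
    Real.inv_rpow hB.le, ← Real.rpow_neg hB.le, Real.sqrt_eq_rpow]
  have e2 : s ^ (((n:ℝ)-2)/2) * s ^ (1/2:ℝ) * s ^ ((1-(n:ℝ))/2) = 1 := by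
    rw [← Real.rpow_add hs, ← Real.rpow_add hs]
    convert Real.rpow_zero s using 2; ring
  have e3 : (1 + s*z^2) ^ (-(n:ℝ)/2) * (1 + s*z^2) ^ (-((1-(n:ℝ))/2)) = (1 + s*z^2) ^ (-(1:ℝ)/2) := by
    rw [← Real.rpow_add hB]; congr 1; ring
  rw [← e3]
  linear_combination ((1 + s*z^2) ^ (-(n:ℝ)/2) * (1 + s*z^2) ^ (-((1-(n:ℝ))/2)) * (1+z^2) ^ ((1-(n:ℝ))/2)) * e2

lemma JJ_lower (n : ℕ) (hn : 3 ≤ n) (t : ℝ) :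
    ENNReal.ofReal (kapR n) ≤ JJ n t ∨ ¬ (0 < t ∧ t < 1) := by
  by_cases h : 0 < t ∧ t < 1
  · left
    obtain ⟨h0, h1⟩ := h
    have hs : 0 < 1 - t^2 := by nlinarith
    rw [← kap_lint n (by omega), JJ]
    refine lintegral_mono fun z => ENNReal.ofReal_le_ofReal ?_
    have : (1+z^2) ^ (-(n:ℝ)/2) = (1+z^2) ^ ((1-(n:ℝ))/2) * (1+z^2) ^ (-(1:ℝ)/2) := by
      rw [← Real.rpow_add (by positivity)]; congr 1; ring
    rw [this]
    refine mul_le_mul_of_nonneg_left ?_ (by positivity)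
    refine Real.rpow_le_rpow_of_nonpos (by positivity) (by nlinarith [sq_nonneg z, mul_nonneg (sq_nonneg t) (sq_nonneg z)]) (by norm_num)
  · right; exact h

lemma JJ_upper (n : ℕ) (hn : 3 ≤ n) (t : ℝ) (h0 : 0 < t) (h1 : t < 1) :
    JJ n t < ENNReal.ofReal (kapR (n-1)) := by
  have hs : 0 < 1 - t^2 := by nlinarith
  have hk := kap_lint (n-1) (by omega)
  have e : ∀ z : ℝ, (1+z^2) ^ (-((n-1:ℕ):ℝ)/2) = (1+z^2) ^ ((1-(n:ℝ))/2) := fun z => by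
    congr 1; push_cast [show 1 ≤ n by omega]; ring
  simp_rw [e] at hk
  have hle : ∀ z ∈ Set.Ioi (0:ℝ), ENNReal.ofReal ((1+z^2) ^ ((1-(n:ℝ))/2) * (1 + (1-t^2)*z^2) ^ (-(1:ℝ)/2)) < ENNReal.ofReal ((1+z^2) ^ ((1-(n:ℝ))/2)) := by
    intro z hz
    have hz : 0 < z := hz
    rw [ENNReal.ofReal_lt_ofReal_iff (by positivity)]
    refine mul_lt_of_lt_one_right (by positivity) ?_
    exact Real.rpow_lt_one_of_one_lt_of_neg (by have : 0 < (1-t^2)*z^2 := by positivity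
                                                linarith) (by norm_num)
  rw [← hk, JJ]
  refine lintegral_strict_mono (by simp) (by fun_prop) ?_ ?_
  · refine ne_top_of_le_ne_top ?_ (lintegral_mono_ae (g := fun z => ENNReal.ofReal ((1+z^2) ^ ((1-(n:ℝ))/2))) ?_)
    · rw [hk]; exact ENNReal.ofReal_ne_top
    · filter_upwards [ae_restrict_mem measurableSet_Ioi] with z hz using (hle z hz).le
  · filter_upwards [ae_restrict_mem measurableSet_Ioi] with z hz using hle z hz

/-- Inner double integral, as a function of `s = t α`. -/
noncomputable def I2 (n : ℕ) (s : ℝ) : ENNReal :=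
  ∫⁻ r in Set.Ioi (0 : ℝ), ∫⁻ r' in Set.Ioi (0 : ℝ),
    ENNReal.ofReal (Real.exp (-(r ^ 2 + r' ^ 2 - 2 * r * r' * s) / 2) * (r * r') ^ ((n : ℝ) - 2))

lemma I2_inner_meas (n : ℕ) : Measurable (fun p : ℝ × ℝ => ∫⁻ r' in Set.Ioi (0 : ℝ),
    ENNReal.ofReal (Real.exp (-(p.2 ^ 2 + r' ^ 2 - 2 * p.2 * r' * p.1) / 2) * (p.2 * r') ^ ((n : ℝ) - 2))) := by
  refine Measurable.lintegral_prod_right' (f := fun q : (ℝ × ℝ) × ℝ => ENNReal.ofReal (Real.exp (-(q.1.2 ^ 2 + q.2 ^ 2 - 2 * q.1.2 * q.2 * q.1.1) / 2) * (q.1.2 * q.2) ^ ((n : ℝ) - 2))) ?_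
  fun_prop

lemma I2_meas (n : ℕ) : Measurable (I2 n) := by
  unfold I2
  exact Measurable.lintegral_prod_right' (I2_inner_meas n)

/-- The constant in front of `psi`. -/
noncomputable def KK (n : ℕ) : ℝ := 1 / (2 ^ ((n : ℝ) - 2) * Real.Gamma ((n : ℝ) / 2) ^ 2)

lemma KK_Crad (n : ℕ) (hn : 1 ≤ n) : 0 < Crad n ∧ 0 < KK n ∧ KK n * (Crad n * Crad n) = 1 := by
  have hn' : (1:ℝ) ≤ n := by exact_mod_cast hn
  have hG := Real.Gamma_pos_of_pos (s := (n:ℝ)/2) (by linarith)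
  refine ⟨by unfold Crad; positivity, by unfold KK; positivity, ?_⟩
  have h2 : (2:ℝ) ^ ((n:ℝ)-2) = 2 ^ ((n:ℝ)/2 - 1) * 2 ^ ((n:ℝ)/2 - 1) := by
    rw [← Real.rpow_add (by norm_num)]; congr 1; ring
  unfold KK Crad
  rw [h2]
  have : (0:ℝ) < 2 ^ ((n:ℝ)/2 - 1) := by positivity
  field_simp

/-- `ENNReal` version of `psi` -/
noncomputable def Psi (n : ℕ) (α : ℝ) : ENNReal :=
  ENNReal.ofReal (KK n) * ∫⁻ t in Set.Ioo (0:ℝ) 1, ENNReal.ofReal ((1 - t ^ 2) ^ (((n : ℝ) - 2) / 2)) * I2 n (t * α)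

lemma Psi_meas (n : ℕ) : Measurable (Psi n) := by
  unfold Psi
  refine Measurable.const_mul ?_ _
  refine Measurable.lintegral_prod_right' (f := fun q : ℝ × ℝ => ENNReal.ofReal ((1 - q.2 ^ 2) ^ (((n : ℝ) - 2) / 2)) * I2 n (q.2 * q.1)) ?_
  exact Measurable.mul (by fun_prop) ((I2_meas n).comp (by fun_prop))

lemma I2_toReal (n : ℕ) (t α : ℝ) (h : I2 n (t * α) < ⊤) :
    (∫ r in Set.Ioi (0 : ℝ), ∫ r' in Set.Ioi (0 : ℝ),
          Real.exp (-(r ^ 2 + r' ^ 2 - 2 * r * r' * t * α) / 2) * (r * r') ^ ((n : ℝ) - 2)) = (I2 n (t * α)).toReal := by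
  have hm : Measurable (fun r : ℝ => ∫⁻ r' in Set.Ioi (0 : ℝ),
    ENNReal.ofReal (Real.exp (-(r ^ 2 + r' ^ 2 - 2 * r * r' * (t*α)) / 2) * (r * r') ^ ((n : ℝ) - 2))) :=
    (I2_inner_meas n).comp (f := fun r : ℝ => (t*α, r)) (by fun_prop)
  unfold I2 at h ⊢
  rw [← integral_toReal hm.aemeasurable (ae_lt_top hm h.ne)]
  refine setIntegral_congr_fun measurableSet_Ioi fun r (hr : 0 < r) => ?_
  beta_reduce
  rw [integral_eq_lintegral_of_nonneg_ae]
  · simp_rw [← mul_assoc]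
  · filter_upwards [ae_restrict_mem measurableSet_Ioi] with r' hr'
    have : (0:ℝ) < r' := hr'
    simp only [Pi.zero_apply]; positivity
  · exact Measurable.aestronglyMeasurable (by fun_prop)

lemma psi_eq (n : ℕ) (hn : 1 ≤ n) (α : ℝ) (h : Psi n α < ⊤) : psi n α = (Psi n α).toReal := by
  have hK := (KK_Crad n hn).2.1
  have hm : Measurable (fun t : ℝ => ENNReal.ofReal ((1 - t ^ 2) ^ (((n : ℝ) - 2) / 2)) * I2 n (t * α)) :=
    Measurable.mul (by fun_prop) ((I2_meas n).comp (by fun_prop))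
  have h1 : (∫⁻ t in Set.Ioo (0:ℝ) 1, ENNReal.ofReal ((1 - t ^ 2) ^ (((n : ℝ) - 2) / 2)) * I2 n (t * α)) ≠ ⊤ := by
    intro hcon
    rw [Psi, hcon, ENNReal.mul_top (by simpa using hK)] at h
    exact lt_irrefl _ h
  have h2 := ae_lt_top hm h1
  rw [Psi, ENNReal.toReal_mul, ENNReal.toReal_ofReal hK.le, ← integral_toReal hm.aemeasurable h2]
  unfold psi KK
  congr 1
  refine integral_congr_ae ?_
  filter_upwards [h2, ae_restrict_mem measurableSet_Ioo] with t ht ht1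
  have hs : 0 < 1 - t^2 := by nlinarith [ht1.1, ht1.2]
  have hI : I2 n (t * α) < ⊤ := by
    rw [lt_top_iff_ne_top]; intro hcon
    rw [hcon, ENNReal.mul_top] at ht
    · exact lt_irrefl _ ht
    · simp; positivity
  rw [I2_toReal n t α hI, ENNReal.toReal_mul, ENNReal.toReal_ofReal (by positivity)]

lemma I2_factor (n : ℕ) (t : ℝ) (x y : EuclideanSpace ℝ (Fin n)) :
    I2 n (t * ⟪x, y⟫) = ∫⁻ r in Set.Ioi (0 : ℝ), ENNReal.ofReal (r^((n:ℝ)-2) * Real.exp (-r^2/2)) *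
      ∫⁻ r' in Set.Ioi (0 : ℝ), ENNReal.ofReal (r'^((n:ℝ)-2) * Real.exp (-r'^2/2)) *
        ENNReal.ofReal (Real.exp (t * ⟪r • x, r' • y⟫)) := by
  unfold I2
  refine setLIntegral_congr_fun measurableSet_Ioi fun r (hr : 0 < r) => ?_
  rw [← lintegral_const_mul' _ _ ENNReal.ofReal_ne_top]
  refine setLIntegral_congr_fun measurableSet_Ioi fun r' (hr' : 0 < r') => ?_
  rw [← ENNReal.ofReal_mul (by positivity), ← ENNReal.ofReal_mul (by positivity)]
  congr 1
  rw [Real.mul_rpow hr.le hr'.le, inner_smul_left, inner_smul_right, conj_trivial]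
  have : Real.exp (-(r ^ 2 + r' ^ 2 - 2 * r * r' * (t * ⟪x, y⟫)) / 2) =
    Real.exp (-r^2/2) * Real.exp (-r'^2/2) * Real.exp (t * (r * (r' * ⟪x, y⟫))) := by
    rw [← Real.exp_add, ← Real.exp_add]; congr 1; ring
  rw [this]; ring

lemma sphere_I2 (n : ℕ) (hn : 2 ≤ n) (t : ℝ) :
    ∫⁻ x, (∫⁻ y, I2 n (t * ⟪x, y⟫) ∂(sphereUniform n)) ∂(sphereUniform n) =
      ENNReal.ofReal (Crad n) * (ENNReal.ofReal (Crad n) * GG n t) := by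
  have hM : Measurable (fun X : EuclideanSpace ℝ (Fin n) => ∫⁻ Y, ENNReal.ofReal (‖Y‖⁻¹) * ENNReal.ofReal (Real.exp (t * ⟪X, Y⟫)) ∂(stdGaussian n)) := by
    refine Measurable.lintegral_prod_right' (f := fun q : EuclideanSpace ℝ (Fin n) × EuclideanSpace ℝ (Fin n) => ENNReal.ofReal (‖q.2‖⁻¹) * ENNReal.ofReal (Real.exp (t * ⟪q.1, q.2⟫))) ?_
    fun_prop
  unfold GG
  rw [← polar_main n hn _ hM, ← lintegral_const_mul' _ _ ENNReal.ofReal_ne_top]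
  refine lintegral_congr fun x => ?_
  simp_rw [I2_factor]
  rw [lintegral_lintegral_swap]
  · rw [← lintegral_const_mul' _ _ ENNReal.ofReal_ne_top]
    refine lintegral_congr fun r => ?_
    rw [lintegral_const_mul' _ _ ENNReal.ofReal_ne_top,
      polar_main n hn (fun Y => ENNReal.ofReal (Real.exp (t * ⟪r • x, Y⟫))) (by fun_prop)]
    ring
  · refine Measurable.aemeasurable ?_
    refine Measurable.mul (by fun_prop) ?_
    refine Measurable.lintegral_prod_right' (f := fun q : (EuclideanSpace ℝ (Fin n) × ℝ) × ℝ => ENNReal.ofReal (q.2^((n:ℝ)-2) * Real.exp (-q.2^2/2)) *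
        ENNReal.ofReal (Real.exp (t * ⟪q.1.2 • x, q.2 • q.1.1⟫))) ?_
    fun_prop

lemma total (n : ℕ) (hn : 2 ≤ n) :
    ∫⁻ x, (∫⁻ y, Psi n ⟪x, y⟫ ∂(sphereUniform n)) ∂(sphereUniform n) =
      ∫⁻ t in Set.Ioo (0:ℝ) 1, ENNReal.ofReal (2/π * kapR n) * JJ n t := by
  have hI := I2_meas n
  have m1 : ∀ x : EuclideanSpace ℝ (Fin n), Measurable (fun q : EuclideanSpace ℝ (Fin n) × ℝ => ENNReal.ofReal ((1 - q.2 ^ 2) ^ (((n : ℝ) - 2) / 2)) * I2 n (q.2 * ⟪x, q.1⟫)) := fun x =>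
    Measurable.mul (by fun_prop) (hI.comp (by fun_prop))
  have h1 : ∀ x : EuclideanSpace ℝ (Fin n), ∫⁻ y, Psi n ⟪x, y⟫ ∂(sphereUniform n) =
      ENNReal.ofReal (KK n) * ∫⁻ t in Set.Ioo (0:ℝ) 1, ENNReal.ofReal ((1 - t ^ 2) ^ (((n : ℝ) - 2) / 2)) *
        ∫⁻ y, I2 n (t * ⟪x, y⟫) ∂(sphereUniform n) := fun x => by
    unfold Psi
    rw [lintegral_const_mul' _ _ ENNReal.ofReal_ne_top, lintegral_lintegral_swap (m1 x).aemeasurable]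
    congr 1
    refine lintegral_congr fun t => ?_
    rw [lintegral_const_mul' _ _ ENNReal.ofReal_ne_top]
  simp_rw [h1]
  rw [lintegral_const_mul' _ _ ENNReal.ofReal_ne_top, lintegral_lintegral_swap, ← lintegral_const_mul' _ _ ENNReal.ofReal_ne_top]
  · refine setLIntegral_congr_fun measurableSet_Ioo fun t ht => ?_
    obtain ⟨hc, hK, hKC⟩ := KK_Crad n (by omega)
    beta_reduce
    rw [lintegral_const_mul' _ _ ENNReal.ofReal_ne_top, sphere_I2 n hn, ← GG_JJ n hn t ht.1 ht.2]
    have : ENNReal.ofReal (KK n) * (ENNReal.ofReal (Crad n) * ENNReal.ofReal (Crad n)) = 1 := by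
      rw [← ENNReal.ofReal_mul hc.le, ← ENNReal.ofReal_mul hK.le, hKC, ENNReal.ofReal_one]
    calc _ = (ENNReal.ofReal (KK n) * (ENNReal.ofReal (Crad n) * ENNReal.ofReal (Crad n))) * (ENNReal.ofReal ((1 - t ^ 2) ^ (((n : ℝ) - 2) / 2)) * GG n t) := by ring
      _ = _ := by rw [this, one_mul]
  · refine Measurable.aemeasurable ?_
    refine Measurable.mul (by fun_prop) ?_
    refine Measurable.lintegral_prod_right' (f := fun q : (EuclideanSpace ℝ (Fin n) × ℝ) × EuclideanSpace ℝ (Fin n) => I2 n (q.1.2 * ⟪q.1.1, q.2⟫)) ?_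
    exact hI.comp (by fun_prop)

lemma real_total (n : ℕ) (hn : 2 ≤ n)
    (hfin : ∫⁻ x, (∫⁻ y, Psi n ⟪x, y⟫ ∂(sphereUniform n)) ∂(sphereUniform n) < ⊤) :
    (∫ x, (∫ y, psi n ⟪x, y⟫ ∂(sphereUniform n)) ∂(sphereUniform n)) =
      (∫⁻ x, (∫⁻ y, Psi n ⟪x, y⟫ ∂(sphereUniform n)) ∂(sphereUniform n)).toReal := by
  have hm : Measurable (fun x : EuclideanSpace ℝ (Fin n) => ∫⁻ y, Psi n ⟪x, y⟫ ∂(sphereUniform n)) := by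
    refine Measurable.lintegral_prod_right' (f := fun q : EuclideanSpace ℝ (Fin n) × EuclideanSpace ℝ (Fin n) => Psi n ⟪q.1, q.2⟫) ?_
    exact (Psi_meas n).comp (by fun_prop)
  have h1 := ae_lt_top hm hfin.ne
  rw [← integral_toReal hm.aemeasurable h1]
  refine integral_congr_ae ?_
  filter_upwards [h1] with x hx
  have hm2 : Measurable (fun y : EuclideanSpace ℝ (Fin n) => Psi n ⟪x, y⟫) := (Psi_meas n).comp (by fun_prop)
  have h2 := ae_lt_top hm2 hx.ne
  rw [← integral_toReal hm2.aemeasurable h2]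
  refine integral_congr_ae ?_
  filter_upwards [h2] with y hy
  exact psi_eq n (by omega) _ hy

lemma total_bounds (n : ℕ) (hn : 3 ≤ n) :
    ENNReal.ofReal (1 / ((n:ℝ)-1)) < (∫⁻ t in Set.Ioo (0:ℝ) 1, ENNReal.ofReal (2/π * kapR n) * JJ n t) ∧
    (∫⁻ t in Set.Ioo (0:ℝ) 1, ENNReal.ofReal (2/π * kapR n) * JJ n t) < ENNReal.ofReal (1 / ((n:ℝ)-2)) := by
  have hn' : (3:ℝ) ≤ n := by exact_mod_cast hn
  have hk := kapR_pos n (by omega)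
  have hk1 := kapR_pos (n+1) (by omega)
  have hpi := pi_pos
  have hup : 2/π * kapR n * kapR (n-1) = 1/((n:ℝ)-2) := by
    obtain ⟨k, rfl⟩ : ∃ k, n = k+3 := ⟨n-3, by omega⟩
    have := kap_prod k
    rw [show k+3-1 = k+2 by omega, mul_assoc, mul_comm (kapR (k+3)), this]
    have : ((k+3:ℕ):ℝ) - 2 = k+1 := by push_cast; ring
    rw [this]; field_simp
  have hlow : 2/π * kapR n * kapR (n+1) = 1/((n:ℝ)-1) := by
    obtain ⟨k, rfl⟩ : ∃ k, n = k+2 := ⟨n-2, by omega⟩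
    have := kap_prod k
    rw [show k+2+1 = k+3 by omega, mul_assoc, this]
    have : ((k+2:ℕ):ℝ) - 1 = k+1 := by push_cast; ring
    rw [this]; field_simp
  have hlt : kapR (n+1) < kapR n := by
    have h1 := (JJ_lower (n+1) (by omega) (1/2)).resolve_right (by norm_num)
    have h2 := JJ_upper (n+1) (by omega) (1/2) (by norm_num) (by norm_num)
    rw [Nat.add_sub_cancel] at h2
    exact (ENNReal.ofReal_lt_ofReal_iff hk).mp (h1.trans_lt h2)
  have hfin : (volume.restrict (Set.Ioo (0:ℝ) 1)) Set.univ = 1 := by simp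
  constructor
  · calc ENNReal.ofReal (1 / ((n:ℝ)-1)) < ENNReal.ofReal (2/π * kapR n * kapR n) := by
          rw [← hlow, ENNReal.ofReal_lt_ofReal_iff (by positivity)]
          gcongr
      _ = ∫⁻ t in Set.Ioo (0:ℝ) 1, ENNReal.ofReal (2/π * kapR n * kapR n) := by
          rw [lintegral_const, hfin, mul_one]
      _ ≤ _ := by
          refine setLIntegral_mono' measurableSet_Ioo fun t ht => ?_
          rw [ENNReal.ofReal_mul (by positivity)]
          gcongr
          exact (JJ_lower n hn t).resolve_right (not_not.mpr ht)
  · have hlt2 : ∀ t ∈ Set.Ioo (0:ℝ) 1, ENNReal.ofReal (2/π * kapR n) * JJ n t < ENNReal.ofReal (1 / ((n:ℝ)-2)) := by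
      intro t ht
      rw [← hup, ENNReal.ofReal_mul (p := 2/π * kapR n) (by positivity)]
      exact ENNReal.mul_lt_mul_right (ENNReal.ofReal_pos.mpr (by positivity)).ne' ENNReal.ofReal_ne_top (JJ_upper n hn t ht.1 ht.2)
    have hc : ∫⁻ t in Set.Ioo (0:ℝ) 1, ENNReal.ofReal (1 / ((n:ℝ)-2)) = ENNReal.ofReal (1 / ((n:ℝ)-2)) := by
      rw [lintegral_const, hfin, mul_one]
    conv_rhs => rw [← hc]
    refine lintegral_strict_mono (by rw [← Measure.measure_univ_ne_zero, hfin]; exact one_ne_zero) (by fun_prop) ?_ ?_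
    · refine ne_top_of_le_ne_top ?_ (setLIntegral_mono' measurableSet_Ioo fun t ht => (hlt2 t ht).le)
      rw [hc]; exact ENNReal.ofReal_ne_top
    · filter_upwards [ae_restrict_mem measurableSet_Ioo] with t ht using hlt2 t ht

/-- The total mass `c_n` of the spherical mixing measure satisfies
`1/(n-1) < c_n < 1/(n-2)`. -/
theorem statement3 (n : ℕ) (hn : 3 ≤ n) :
    1 / ((n : ℝ) - 1) <
        (∫ x, (∫ y, psi n ⟪x, y⟫ ∂(sphereUniform n)) ∂(sphereUniform n)) ∧
      (∫ x, (∫ y, psi n ⟪x, y⟫ ∂(sphereUniform n)) ∂(sphereUniform n)) <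
        1 / ((n : ℝ) - 2) := by
  have hb := total_bounds n hn
  rw [← total n (by omega)] at hb
  have hfin := hb.2.trans ENNReal.ofReal_lt_top
  rw [real_total n (by omega) hfin]
  have hn' : (3:ℝ) ≤ n := by exact_mod_cast hn
  constructor
  · rw [← ENNReal.ofReal_lt_iff_lt_toReal _ hfin.ne]
    · exact hb.1
    · exact div_nonneg zero_le_one (by linarith)
  · rw [← ENNReal.lt_ofReal_iff_toReal_lt hfin.ne]
    exact hb.2
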